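/- Fix an integer N ≥ 2 and let μ be a non-atomic Borel probability measure on [0,1] such that F_{N,0} is twice continuously differentiable on [0,1]. Define f_{N,n}(x) := (x+N−1)·F'_{N,n}(x) and M_{N,n} := max_{x∈[0,1]} |f'_{N,n}(x)|. Then for every n ∈ ℕ, M_{N,n} ≤ q_N^n · M_{N,0}, where q_N := Σ_{i≥N} (1/i³ + N/(i²(i+1))). -/

import Mathlib

open MeasureTheory Set Filter

/-- The Rényi-type continued fraction transformation
`R_N(x) = N/(1-x) - ⌊N/(1-x)⌋` for `x ≠ 1`, and `R_N(1) = 0`. -/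
noncomputable def renyiMap (N : ℕ) (x : ℝ) : ℝ :=
  if x = 1 then 0 else Int.fract ((N : ℝ) / (1 - x))

/-- `F_{N,n}(x) = μ {y ∈ [0,1] : R_N^n(y) ≤ x}`. -/
noncomputable def Fdist (N : ℕ) (μ : Measure ℝ) (n : ℕ) (x : ℝ) : ℝ :=
  (μ {y ∈ Icc (0 : ℝ) 1 | (renyiMap N)^[n] y ≤ x}).toReal

/-- `f_{N,n}(x) = (x+N-1) F'_{N,n}(x)`. -/
noncomputable def fDens (N : ℕ) (μ : Measure ℝ) (n : ℕ) (x : ℝ) : ℝ :=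
  (x + N - 1) * derivWithin (Fdist N μ n) (Icc 0 1) x

/-- `M_{N,n} = max_{x ∈ [0,1]} |f'_{N,n}(x)|`. -/
noncomputable def Mconst (N : ℕ) (μ : Measure ℝ) (n : ℕ) : ℝ :=
  sSup ((fun x => |derivWithin (fDens N μ n) (Icc 0 1) x|) '' Icc (0 : ℝ) 1)

/-- `q_N = ∑_{i ≥ N} (1/i³ + N/(i²(i+1)))`, written as a sum over `i = j + N`, `j : ℕ`. -/
noncomputable def qConst (N : ℕ) : ℝ :=
  ∑' j : ℕ, (1 / (((j + N : ℕ) : ℝ)) ^ 3 +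
    (N : ℝ) / ((((j + N : ℕ) : ℝ)) ^ 2 * (((j + N : ℕ) : ℝ) + 1)))


/-- A function differentiable on `[0,1]` extends to a differentiable function on `ℝ` whose
derivative is constant on each side of the interval. -/
theorem exists_hasDerivAt_extension {f f' : ℝ → ℝ}
    (hf : ∀ x ∈ Icc (0 : ℝ) 1, HasDerivWithinAt f (f' x) (Icc 0 1) x) :
    ∃ g : ℝ → ℝ, EqOn g f (Icc 0 1) ∧
      ∀ x, HasDerivAt g (f' (projIcc (0 : ℝ) 1 zero_le_one x)) x := by
  let g : ℝ → ℝ := fun x =>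
    if x < 0 then f 0 + f' 0 * x else if x ≤ 1 then f x else f 1 + f' 1 * (x - 1)
  have hgf : EqOn g f (Icc 0 1) := fun x hx => by
    simp [g, not_lt.2 hx.1, hx.2]
  have hg0 : EqOn g (fun x => f 0 + f' 0 * x) (Iic 0) := fun x hx => by
    rcases (mem_Iic.1 hx).lt_or_eq with h | rfl
    · simp [g, h]
    · simp [g]
  have hg1 : EqOn g (fun x => f 1 + f' 1 * (x - 1)) (Ici 1) := fun x hx => by
    rcases (mem_Ici.1 hx).lt_or_eq with h | rfl
    · simp [g, not_lt.2 (zero_le_one.trans h.le), not_le.2 h]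
    · simp [g]
  refine ⟨g, hgf, fun x => ?_⟩
  have key : ∀ (s : Set ℝ) (d : ℝ), IsClosed s → (x ∈ s → HasDerivWithinAt g d s x) →
      HasDerivWithinAt g d s x := fun s d hs h => by
    by_cases hx : x ∈ s
    · exact h hx
    · exact HasFDerivWithinAt.of_notMem_closure (by rwa [hs.closure_eq])
  have hA : HasDerivWithinAt g (f' (projIcc (0 : ℝ) 1 zero_le_one x)) (Iic 0) x := by
    refine key _ _ isClosed_Iic fun hx => ?_
    rw [projIcc_of_le_left _ hx]
    have : HasDerivAt (fun x => f 0 + f' 0 * x) (f' 0) x := by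
      simpa using ((hasDerivAt_id x).const_mul (f' 0)).const_add (f 0)
    exact this.hasDerivWithinAt.congr hg0 (hg0 hx)
  have hB : HasDerivWithinAt g (f' (projIcc (0 : ℝ) 1 zero_le_one x)) (Icc 0 1) x := by
    refine key _ _ isClosed_Icc fun hx => ?_
    rw [projIcc_of_mem _ hx]
    exact (hf x hx).congr hgf (hgf hx)
  have hC : HasDerivWithinAt g (f' (projIcc (0 : ℝ) 1 zero_le_one x)) (Ici 1) x := by
    refine key _ _ isClosed_Ici fun hx => ?_
    rw [projIcc_of_right_le _ hx]
    have : HasDerivAt (fun x => f 1 + f' 1 * (x - 1)) (f' 1) x := by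
      simpa using (((hasDerivAt_id x).sub_const 1).const_mul (f' 1)).const_add (f 1)
    exact this.hasDerivWithinAt.congr hg1 (hg1 hx)
  have := (hA.union hB).union hC
  rwa [Iic_union_Icc_eq_Iic zero_le_one, Iic_union_Ici, hasDerivWithinAt_univ] at this

/-- The inverse branch of `renyiMap N` on the interval where `⌊N/(1-x)⌋ = N + d`. -/
noncomputable def renyiBranch (N d : ℕ) (z : ℝ) : ℝ := 1 - N / (N + d + z)

theorem measurable_renyiMap (N : ℕ) : Measurable (renyiMap N) := by
  unfold renyiMap
  refine Measurable.ite (measurableSet_singleton 1) measurable_const ?_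
  exact Measurable.fract (by fun_prop)

theorem countable_renyiMap_preimage_singleton (N : ℕ) (hN : 2 ≤ N) (a : ℝ) :
    (renyiMap N ⁻¹' {a}).Countable := by
  have hN' : (2 : ℝ) ≤ N := by exact_mod_cast hN
  refine ((countable_singleton (1 : ℝ)).union
    (countable_range fun k : ℤ => 1 - N / (k + a))).mono fun y hy => ?_
  by_cases h1 : y = 1
  · exact Or.inl h1
  refine Or.inr ⟨⌊(N : ℝ) / (1 - y)⌋, ?_⟩
  have hy' : Int.fract ((N : ℝ) / (1 - y)) = a := by simpa [renyiMap, h1] using hy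
  have h2 : (1 - y) ≠ 0 := sub_ne_zero.2 (Ne.symm h1)
  have : (⌊(N : ℝ) / (1 - y)⌋ : ℝ) + a = N / (1 - y) := by
    rw [← hy']; exact Int.floor_add_fract _
  simp only [this]
  field_simp
  ring

theorem renyiMap_mem_Icc (N : ℕ) (y : ℝ) : renyiMap N y ∈ Icc (0 : ℝ) 1 := by
  unfold renyiMap
  split_ifs
  · simp
  · exact ⟨Int.fract_nonneg _, (Int.fract_lt_one _).le⟩

theorem renyiBranch_lt_iff {N d : ℕ} {x y : ℝ} (hN : 0 < N) (hx : 0 ≤ x) (hy : y < 1) :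
    renyiBranch N d x < y ↔ N + d + x < N / (1 - y) := by
  have hN' : (0 : ℝ) < N := by exact_mod_cast hN
  have : (0 : ℝ) < N + d + x := by positivity
  rw [renyiBranch, sub_lt_comm, lt_div_iff₀ this, lt_div_iff₀ (sub_pos.2 hy), mul_comm]

theorem le_renyiBranch_iff {N d : ℕ} {x y : ℝ} (hN : 0 < N) (hx : 0 ≤ x) (hy : y < 1) :
    y ≤ renyiBranch N d x ↔ N / (1 - y) ≤ N + d + x := by
  rw [← not_lt, renyiBranch_lt_iff hN hx hy, not_lt]

theorem renyiBranch_lt_one {N d : ℕ} {x : ℝ} (hN : 0 < N) (hx : 0 ≤ x) :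
    renyiBranch N d x < 1 := by
  have hN' : (0 : ℝ) < N := by exact_mod_cast hN
  have : (0 : ℝ) < N + d + x := by positivity
  rw [renyiBranch]
  linarith [div_pos hN' this]

theorem renyiBranch_nonneg {N d : ℕ} {x : ℝ} (hN : 0 < N) (hx : 0 ≤ x) :
    0 ≤ renyiBranch N d x := by
  have hN' : (0 : ℝ) < N := by exact_mod_cast hN
  have : (0 : ℝ) < N + d + x := by positivity
  rw [renyiBranch, sub_nonneg, div_le_one this]
  linarith [Nat.cast_nonneg (α := ℝ) d]

theorem renyiBranch_le_of_le {N d : ℕ} {x y : ℝ} (hN : 0 < N) (hx : 0 ≤ x) (hxy : x ≤ y) :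
    renyiBranch N d x ≤ renyiBranch N d y := by
  have hN' : (0 : ℝ) < N := by exact_mod_cast hN
  have : (0 : ℝ) < N + d + x := by positivity
  unfold renyiBranch
  gcongr

theorem renyiBranch_monotone_index {N : ℕ} {x : ℝ} (hN : 0 < N) (hx : 0 ≤ x) :
    Monotone fun d => renyiBranch N d x := fun d e hde => by
  have hN' : (0 : ℝ) < N := by exact_mod_cast hN
  have : (0 : ℝ) < N + d + x := by positivity
  have h : (d : ℝ) ≤ e := by exact_mod_cast hde
  simp only [renyiBranch]
  gcongr

/-- Distribution function of the push-forward of a non-atomic measure on `[0,1]` by `renyiMap N`. -/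
theorem hasSum_map_renyiMap_Iic {N : ℕ} (hN : 2 ≤ N) (ν : Measure ℝ) [IsFiniteMeasure ν]
    [NullSingletonClass ν] (hν : ν (Icc (0 : ℝ) 1)ᶜ = 0) {x : ℝ} (hx : x ∈ Icc (0 : ℝ) 1) :
    HasSum (fun d => ν.real (Iic (renyiBranch N d x)) - ν.real (Iic (renyiBranch N d 0)))
      ((ν.map (renyiMap N)).real (Iic x)) := by
  have hN0 : 0 < N := by omega
  have hN' : (2 : ℝ) ≤ N := by exact_mod_cast hN
  have hle : ∀ d, renyiBranch N d 0 ≤ renyiBranch N d x := fun d =>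
    renyiBranch_le_of_le hN0 le_rfl hx.1
  have hae : renyiMap N ⁻¹' Iic x =ᵐ[ν] ⋃ d, Ioc (renyiBranch N d 0) (renyiBranch N d x) := by
    have h1 : ∀ᵐ y ∂ν, y ∈ Icc (0 : ℝ) 1 := hν
    have h2 : ∀ᵐ y ∂ν, y ∉ renyiMap N ⁻¹' {0} :=
      measure_eq_zero_iff_ae_notMem.1 ((countable_renyiMap_preimage_singleton N hN 0).measure_zero ν)
    filter_upwards [h1, h2] with y hy hy0
    have hy1 : y ≠ 1 := by rintro rfl; exact hy0 (by simp [renyiMap])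
    have hylt : y < 1 := lt_of_le_of_ne hy.2 hy1
    have hpos : 0 < 1 - y := sub_pos.2 hylt
    have hfr : Int.fract ((N : ℝ) / (1 - y)) ≠ 0 := by simpa [renyiMap, hy1] using hy0
    have hNt : (N : ℝ) ≤ N / (1 - y) := by
      rw [le_div_iff₀ hpos]; nlinarith [hy.1]
    refine propext ?_
    change renyiMap N y ≤ x ↔ y ∈ ⋃ d, Ioc (renyiBranch N d 0) (renyiBranch N d x)
    rw [mem_iUnion]
    simp only [renyiMap, hy1, if_false, mem_Ioc, renyiBranch_lt_iff hN0 le_rfl hylt,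
      le_renyiBranch_iff hN0 hx.1 hylt]
    generalize (N : ℝ) / (1 - y) = t at *
    have hfpos : 0 < Int.fract t := lt_of_le_of_ne (Int.fract_nonneg t) (Ne.symm hfr)
    constructor
    · intro h
      have h3 : (N : ℤ) ≤ ⌊t⌋ := Int.le_floor.2 (by exact_mod_cast hNt)
      obtain ⟨d, hd⟩ := Int.le.dest h3
      have hd' : (N : ℝ) + d = ⌊t⌋ := by exact_mod_cast hd
      have := Int.floor_add_fract t
      exact ⟨d, by linarith, by linarith⟩
    · rintro ⟨d, h3, h4⟩
      have h5 : t ≠ ((N + d + 1 : ℤ) : ℝ) := fun h => hfr (by rw [h]; exact Int.fract_intCast _)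
      have h6 : t < N + d + 1 := lt_of_le_of_ne (by linarith [hx.2]) (by exact_mod_cast h5)
      have h7 : ⌊t⌋ = (N + d : ℤ) := Int.floor_eq_iff.2 ⟨by push_cast; linarith, by push_cast; linarith⟩
      have h8 := Int.floor_add_fract t
      rw [h7] at h8
      push_cast at h8
      linarith
  have hdisj : Pairwise
      (Function.onFun Disjoint fun d => Ioc (renyiBranch N d 0) (renyiBranch N d x)) := by
    refine (pairwise_disjoint_on _).2 fun d e hde => ?_
    rw [Set.disjoint_left]
    rintro y ⟨-, h1⟩ ⟨h2, -⟩
    have h3 : renyiBranch N d x ≤ renyiBranch N e 0 := by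
      have h4 : (d : ℝ) + 1 ≤ e := by exact_mod_cast hde
      have h5 : (0 : ℝ) < N + d + x := by have := hx.1; positivity
      unfold renyiBranch
      gcongr 1 - N / ?_
      linarith [hx.2]
    linarith
  have hmeas := measure_iUnion (μ := ν) hdisj fun d => measurableSet_Ioc
  have hreal : (ν.map (renyiMap N)).real (Iic x) =
      (∑' d, ν (Ioc (renyiBranch N d 0) (renyiBranch N d x))).toReal := by
    rw [measureReal_def, Measure.map_apply (measurable_renyiMap N) measurableSet_Iic,
      measure_congr hae, hmeas]
  have hterm : ∀ d, ν.real (Iic (renyiBranch N d x)) - ν.real (Iic (renyiBranch N d 0)) =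
      (ν (Ioc (renyiBranch N d 0) (renyiBranch N d x))).toReal := fun d => by
    rw [← measureReal_sdiff (Iic_subset_Iic.2 (hle d)) measurableSet_Iic, Iic_sdiff_Iic,
      measureReal_def]
  simp only [hterm]
  rw [hreal, ENNReal.tsum_toReal_eq fun d => measure_ne_top _ _]
  exact ENNReal.hasSum_toReal (by rw [← hmeas]; exact measure_ne_top _ _)

theorem Fdist_eq_map_iterate (N : ℕ) (μ : Measure ℝ) (n : ℕ) (x : ℝ) :
    Fdist N μ n x = ((μ.restrict (Icc 0 1)).map (renyiMap N)^[n]).real (Iic x) := by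
  have hm := (measurable_renyiMap N).iterate n
  rw [Fdist, measureReal_def, Measure.map_apply hm measurableSet_Iic,
    Measure.restrict_apply (hm measurableSet_Iic), inter_comm]
  rfl

/-- The Gauss–Kuzmin recursion for the distribution functions. -/
theorem hasSum_Fdist_succ {N : ℕ} (hN : 2 ≤ N) (μ : Measure ℝ) [IsFiniteMeasure μ]
    [NullSingletonClass μ] (n : ℕ) {x : ℝ} (hx : x ∈ Icc (0 : ℝ) 1) :
    HasSum (fun d => Fdist N μ n (renyiBranch N d x) - Fdist N μ n (renyiBranch N d 0))
      (Fdist N μ (n + 1) x) := by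
  have hm := fun k => (measurable_renyiMap N).iterate k
  let ν : ℕ → Measure ℝ := fun k => (μ.restrict (Icc 0 1)).map (renyiMap N)^[k]
  have hsucc : ∀ k, ν (k + 1) = (ν k).map (renyiMap N) := fun k => by
    simp only [ν]
    rw [Measure.map_map (measurable_renyiMap N) (hm k), Function.iterate_succ']
  have hinv : ∀ k, NullSingletonClass (ν k) ∧ ν k (Icc (0 : ℝ) 1)ᶜ = 0 := by
    intro k
    induction k with
    | zero =>
      simp only [ν, Function.iterate_zero, Measure.map_id]
      exact ⟨inferInstance, by simp [measurableSet_Icc.compl]⟩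
    | succ k ih =>
      obtain ⟨_, -⟩ := ih
      rw [hsucc]
      refine ⟨⟨fun a => ?_⟩, ?_⟩
      · rw [Measure.map_apply (measurable_renyiMap N) (measurableSet_singleton a)]
        exact (countable_renyiMap_preimage_singleton N hN a).measure_zero _
      · rw [Measure.map_apply (measurable_renyiMap N) measurableSet_Icc.compl]
        have : renyiMap N ⁻¹' (Icc (0 : ℝ) 1)ᶜ = ∅ :=
          eq_empty_of_forall_notMem fun y hy => hy (renyiMap_mem_Icc N y)
        rw [this, measure_empty]
  obtain ⟨_, h0⟩ := hinv n
  have := hasSum_map_renyiMap_Iic hN (ν n) h0 hx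
  rw [← hsucc] at this
  simpa only [Fdist_eq_map_iterate] using this

/-- The transition weight of the branch `renyiBranch N d`. -/
noncomputable def renyiWeight (N d : ℕ) (z : ℝ) : ℝ :=
  (z + N - 1) / ((N + d + z - 1) * (N + d + z))

/-- The derivative of `renyiWeight N d`. -/
noncomputable def renyiWeightDeriv (N d : ℕ) (z : ℝ) : ℝ :=
  ((d : ℝ) ^ 2 + d - (z + N - 1) ^ 2) / ((N + d + z - 1) ^ 2 * (N + d + z) ^ 2)

section Estimates

variable {N : ℕ} {z : ℝ}

theorem hasDerivAt_renyiBranch (d : ℕ) (hz : (N : ℝ) + d + z ≠ 0) :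
    HasDerivAt (renyiBranch N d) (N / (N + d + z) ^ 2) z := by
  have h := (((hasDerivAt_id z).const_add ((N : ℝ) + d)).inv hz).const_mul (N : ℝ)
  have h' := h.const_sub 1
  refine (h'.congr_deriv ?_).congr_of_eventuallyEq (.of_forall fun y => ?_)
  · simp only [id]; field_simp
  · simp [renyiBranch, div_eq_mul_inv]

theorem hasDerivAt_renyiWeight (d : ℕ) (hz : 0 < (N : ℝ) + d + z - 1) :
    HasDerivAt (renyiWeight N d) (renyiWeightDeriv N d z) z := by
  have hz' : 0 < (N : ℝ) + d + z := by linarith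
  have h1 : HasDerivAt (fun y : ℝ => y + N - 1) 1 z :=
    ((hasDerivAt_id z).add_const (N : ℝ)).sub_const 1
  have h3 : HasDerivAt (fun y : ℝ => (N : ℝ) + d + y) 1 z := (hasDerivAt_id z).const_add _
  have h2 : HasDerivAt (fun y : ℝ => (N : ℝ) + d + y - 1) 1 z := h3.sub_const 1
  refine (h1.div (h2.mul h3) (mul_pos hz hz').ne').congr_deriv ?_
  simp only [renyiWeightDeriv, Pi.mul_apply]
  rw [← mul_pow]
  congr 1
  ring

theorem abs_renyiBranch_le_one (hN : 2 ≤ N) (d : ℕ) (hz : z ∈ Ioo (-1 / 2 : ℝ) (3 / 2)) :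
    |renyiBranch N d z| ≤ 1 := by
  have hN' : (2 : ℝ) ≤ N := by exact_mod_cast hN
  have hd : (0 : ℝ) ≤ d := d.cast_nonneg
  have hb : 0 < (N : ℝ) + d + z := by linarith [hz.1]
  have h1 : 0 < N / ((N : ℝ) + d + z) := by positivity
  have h2 : N / ((N : ℝ) + d + z) ≤ 2 := by rw [div_le_iff₀ hb]; linarith [hz.1]
  rw [renyiBranch, abs_le]
  constructor <;> linarith

theorem one_div_mul_le (hN : 2 ≤ N) (d : ℕ) (hz : -1 / 2 < z) :
    1 / (((N : ℝ) + d + z - 1) * (N + d + z)) ≤ 2 * (1 / ((d : ℝ) + 1) ^ 2) := by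
  have hN' : (2 : ℝ) ≤ N := by exact_mod_cast hN
  have hd : (0 : ℝ) ≤ d := d.cast_nonneg
  rw [mul_one_div, div_le_div_iff₀ (mul_pos (by linarith) (by linarith)) (by positivity)]
  have h1 : ((d : ℝ) + 1) / 2 ≤ N + d + z - 1 := by linarith
  have h2 : (d : ℝ) + 1 ≤ N + d + z := by linarith
  nlinarith [mul_le_mul h1 h2 (by positivity) (by linarith)]

theorem abs_renyiWeight_le (hN : 2 ≤ N) (d : ℕ) (hz : z ∈ Ioo (-1 / 2 : ℝ) (3 / 2)) :
    |renyiWeight N d z| ≤ (N + 1) * (2 * (1 / ((d : ℝ) + 1) ^ 2)) := by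
  have hN' : (2 : ℝ) ≤ N := by exact_mod_cast hN
  have hd : (0 : ℝ) ≤ d := d.cast_nonneg
  have h0 : 0 < ((N : ℝ) + d + z - 1) * (N + d + z) :=
    mul_pos (by linarith [hz.1]) (by linarith [hz.1])
  have h1 : 0 ≤ z + N - 1 := by linarith [hz.1]
  rw [renyiWeight, abs_of_nonneg (by positivity), div_eq_mul_one_div]
  exact mul_le_mul (by linarith [hz.2]) (one_div_mul_le hN d hz.1) (by positivity) (by positivity)

theorem abs_renyiWeightDeriv_le (hN : 2 ≤ N) (d : ℕ) (hz : -1 / 2 < z) :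
    |renyiWeightDeriv N d z| ≤ 2 * (1 / ((d : ℝ) + 1) ^ 2) := by
  have hN' : (2 : ℝ) ≤ N := by exact_mod_cast hN
  have hd : (0 : ℝ) ≤ d := d.cast_nonneg
  refine le_trans ?_ (one_div_mul_le hN d hz)
  have h1 : 0 < (N : ℝ) + d + z - 1 := by linarith
  have h2 : 0 < (N : ℝ) + d + z := by linarith
  rw [renyiWeightDeriv, abs_div, abs_of_pos (a := _ * _) (by positivity),
    div_le_div_iff₀ (by positivity) (by positivity), ← mul_pow, one_mul, pow_two (_ * _)]
  refine mul_le_mul_of_nonneg_right ?_ (by positivity)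
  rw [abs_le]
  constructor
  · nlinarith
  · nlinarith

theorem abs_renyiBranch_deriv_le (hN : 2 ≤ N) (d : ℕ) (hz : -1 / 2 < z) :
    |(N : ℝ) / (N + d + z) ^ 2| ≤ N * (1 / ((d : ℝ) + 1) ^ 2) := by
  have hN' : (2 : ℝ) ≤ N := by exact_mod_cast hN
  have hd : (0 : ℝ) ≤ d := d.cast_nonneg
  have h2 : (d : ℝ) + 1 ≤ N + d + z := by linarith
  rw [abs_of_nonneg (by positivity), mul_one_div]
  gcongr

theorem summable_one_div_succ_sq : Summable fun d : ℕ => 1 / ((d : ℝ) + 1) ^ 2 := by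
  have := (summable_nat_add_iff 1).2 (Real.summable_one_div_nat_pow.2 one_lt_two)
  simpa using this

theorem renyiWeightDeriv_eq_sub (hN : 2 ≤ N) (d : ℕ) (hz : 0 ≤ z) :
    renyiWeightDeriv N d z = d / ((N : ℝ) + d + z - 1) ^ 2 -
      ((d + 1 : ℕ) : ℝ) / ((N : ℝ) + (d + 1 : ℕ) + z - 1) ^ 2 := by
  have hN' : (2 : ℝ) ≤ N := by exact_mod_cast hN
  have hd : (0 : ℝ) ≤ d := d.cast_nonneg
  have h1 : (N : ℝ) + d + z - 1 ≠ 0 := by linarith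
  have h2 : (N : ℝ) + d + z ≠ 0 := by linarith
  have h3 : (N : ℝ) + (d + 1 : ℕ) + z - 1 = N + d + z := by push_cast; ring
  rw [h3, renyiWeightDeriv, div_sub_div _ _ (pow_ne_zero 2 h1) (pow_ne_zero 2 h2)]
  congr 1
  push_cast
  ring

theorem tendsto_div_sq_atTop (hN : 2 ≤ N) (hz : 0 ≤ z) :
    Tendsto (fun d : ℕ => (d : ℝ) / ((N : ℝ) + d + z - 1) ^ 2) atTop (nhds 0) := by
  have hN' : (2 : ℝ) ≤ N := by exact_mod_cast hN
  refine squeeze_zero (fun d => by positivity) (fun d => ?_)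
    (tendsto_one_div_add_atTop_nhds_zero_nat (𝕜 := ℝ))
  have hd : (0 : ℝ) ≤ d := d.cast_nonneg
  have h1 : (d : ℝ) + 1 ≤ N + d + z - 1 := by linarith
  rw [div_le_div_iff₀ (by have : 0 < (N : ℝ) + d + z - 1 := by linarith
                          positivity) (by positivity)]
  nlinarith

theorem hasSum_renyiWeightDeriv (hN : 2 ≤ N) (hz : 0 ≤ z) :
    HasSum (fun d => renyiWeightDeriv N d z) 0 := by
  have hs : Summable fun d => renyiWeightDeriv N d z :=
    .of_norm_bounded (summable_one_div_succ_sq.mul_left 2)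
      fun d => abs_renyiWeightDeriv_le hN d (by linarith)
  rw [hs.hasSum_iff_tendsto_nat]
  simp only [renyiWeightDeriv_eq_sub hN _ hz]
  simp only [Finset.sum_range_sub' fun d : ℕ => (d : ℝ) / ((N : ℝ) + d + z - 1) ^ 2]
  simpa using (tendsto_div_sq_atTop hN hz).const_sub 0

/-- Comparison of series up to a telescoping correction. -/
theorem HasSum.le_of_le_sub_telescoping {s t W : ℕ → ℝ} {S T : ℝ} (hs : HasSum s S)
    (ht : HasSum t T) (h : ∀ d, s d ≤ t d - (W d - W (d + 1))) (hW : Tendsto W atTop (nhds 0))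
    (hW0 : 0 ≤ W 0) : S ≤ T := by
  have h1 := hs.tendsto_sum_nat
  have h2 := (ht.tendsto_sum_nat.sub_const (W 0)).add hW
  have : S ≤ T - W 0 + 0 := le_of_tendsto_of_tendsto' h1 h2 fun n => by
    have := Finset.sum_le_sum fun d (_ : d ∈ Finset.range n) => h d
    rw [Finset.sum_sub_distrib, Finset.sum_range_sub'] at this
    linarith
  linarith

theorem telescoping_inverse_cube {b : ℝ} (hb : 1 ≤ b) :
    1 / (2 * b ^ 2 - 2 * b + 1) - 1 / (2 * (b + 1) ^ 2 - 2 * (b + 1) + 1) ≤ 1 / b ^ 3 := by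
  have h1 : 0 < 2 * b ^ 2 - 2 * b + 1 := by nlinarith
  have h2 : 0 < 2 * (b + 1) ^ 2 - 2 * (b + 1) + 1 := by nlinarith
  rw [div_sub_div _ _ h1.ne' h2.ne', div_le_div_iff₀ (by positivity) (by positivity)]
  nlinarith

theorem inv_sq_sub_inv_sq_ge {m x : ℝ} (hm : 0 < m) (hx : 0 ≤ x) :
    2 * x / (m + x) ^ 3 ≤ 1 / m ^ 2 - 1 / (m + x) ^ 2 := by
  have : 0 < m + x := by linarith
  rw [div_sub_div _ _ (by positivity) (by positivity), div_le_div_iff₀ (by positivity)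
    (by positivity)]
  have : (1 * (m + x) ^ 2 - m ^ 2 * 1) * (m + x) ^ 3 - 2 * x * (m ^ 2 * (m + x) ^ 2) =
      (m + x) ^ 2 * (x ^ 2 * (3 * m + x)) := by ring
  have : 0 ≤ (m + x) ^ 2 * (x ^ 2 * (3 * m + x)) := by positivity
  linarith

theorem tendsto_inverse_quadratic {c : ℝ} (hc : 2 ≤ c) :
    Tendsto (fun d : ℕ => 1 / (2 * (c + d) ^ 2 - 2 * (c + d) + 1)) atTop (nhds 0) := by
  refine squeeze_zero (fun d => ?_) (fun d => ?_)
    (tendsto_one_div_add_atTop_nhds_zero_nat (𝕜 := ℝ))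
  all_goals have hd : (0 : ℝ) ≤ d := d.cast_nonneg
  · have : 0 < 2 * (c + d) ^ 2 - 2 * (c + d) + 1 := by nlinarith
    positivity
  · apply one_div_le_one_div_of_le (by positivity)
    nlinarith

/-- The series whose value is the derivative of the transfer operator applied to the identity. -/
theorem renyi_series_le_qConst (hN : 2 ≤ N) (hz : z ∈ Icc (0 : ℝ) 1) (c : ℝ) {S : ℝ}
    (hS : HasSum (fun d => renyiWeightDeriv N d z * (renyiBranch N d z - c) +
      renyiWeight N d z * (N / (N + d + z) ^ 2)) S) : S ≤ qConst N := by
  have hN' : (2 : ℝ) ≤ N := by exact_mod_cast hN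
  have hz0 := hz.1
  have hq : Summable fun j : ℕ => (1 / (((j + N : ℕ) : ℝ)) ^ 3 +
      (N : ℝ) / ((((j + N : ℕ) : ℝ)) ^ 2 * (((j + N : ℕ) : ℝ) + 1))) := by
    refine .of_nonneg_of_le (fun j => by positivity) (fun j => ?_)
      (summable_one_div_succ_sq.mul_left 2)
    have hj : (0 : ℝ) ≤ j := j.cast_nonneg
    have h1 : (j : ℝ) + 1 ≤ (j + N : ℕ) := by push_cast; linarith
    have h2 : (N : ℝ) ≤ (j + N : ℕ) := by push_cast; linarith
    generalize ((j + N : ℕ) : ℝ) = m at *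
    have hm : 0 < m := by linarith
    have h3 : 1 / m ^ 3 ≤ 1 / m ^ 2 :=
      one_div_le_one_div_of_le (by positivity) (by nlinarith [sq_nonneg m])
    have h4 : (N : ℝ) / (m ^ 2 * (m + 1)) ≤ 1 / m ^ 2 := by
      rw [div_le_div_iff₀ (by positivity) (by positivity)]; nlinarith [sq_nonneg m]
    have h5 : 1 / m ^ 2 ≤ 1 / ((j : ℝ) + 1) ^ 2 := by gcongr
    linarith
  let τ : ℝ → ℝ := fun b => 1 / (2 * b ^ 2 - 2 * b + 1)
  let W : ℕ → ℝ := fun d => τ (N + d) - N / (N + d) +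
    2 * N * (2 * z + N - 1) * τ (N + z + d) -
    (1 - N - c) * (d / ((N : ℝ) + d + z - 1) ^ 2)
  refine hS.le_of_le_sub_telescoping (W := W) hq.hasSum (fun d => ?_) ?_ ?_
  · have hd : (0 : ℝ) ≤ d := d.cast_nonneg
    have hb : 0 < (N : ℝ) + d + z := by linarith
    have hb1 : 0 < (N : ℝ) + d + z - 1 := by linarith
    have hm : 0 < (N : ℝ) + d := by linarith
    have hr : renyiWeightDeriv N d z * (renyiBranch N d z - c) +
        renyiWeight N d z * (N / (N + d + z) ^ 2) =
        N * (1 / (N + d + z) ^ 2 - 2 * (z + N - 1) / (N + d + z) ^ 3) +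
          (1 - N - c) * renyiWeightDeriv N d z := by
      simp only [renyiWeightDeriv, renyiWeight, renyiBranch]
      field_simp
      ring
    have hA := renyiWeightDeriv_eq_sub hN d hz0
    have t1 := telescoping_inverse_cube (b := N + d) (by linarith)
    have t2 := telescoping_inverse_cube (b := N + z + d) (by linarith)
    have t3 := mul_le_mul_of_nonneg_left t2
      (show 0 ≤ 2 * (N : ℝ) * (2 * z + N - 1) by
        have : 0 ≤ 2 * z + N - 1 := by linarith
        positivity)
    have t4 := mul_le_mul_of_nonneg_left (inv_sq_sub_inv_sq_ge hm hz0) (show (0 : ℝ) ≤ N by linarith)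
    have t5 : (N : ℝ) / ((N + d) ^ 2 * ((N + d) + 1)) =
        N / (N + d) ^ 2 - (N / (N + d) - N / (N + d + 1)) := by
      field_simp
      ring
    have t6 : N * (1 / ((N : ℝ) + d + z) ^ 2 - 2 * (z + N - 1) / (N + d + z) ^ 3) =
        N * (1 / ((N : ℝ) + d + z) ^ 2) + N * (2 * z / (N + d + z) ^ 3) -
          2 * N * (2 * z + N - 1) * (1 / (N + z + d) ^ 3) := by
      rw [show (N : ℝ) + z + d = N + d + z by ring]; ring
    rw [hr, t6, hA]
    simp only [W, τ]
    push_cast at t5 ⊢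
    rw [add_comm (d : ℝ) N, t5, ← add_assoc (N : ℝ) d 1, ← add_assoc (N + z : ℝ) d 1]
    rw [mul_sub] at t3 t4
    simp only [div_eq_mul_one_div (N : ℝ) ((N + d) ^ 2)]
    linarith
  · have e1 := tendsto_inverse_quadratic hN'
    have e2 := (tendsto_inverse_quadratic (c := N + z) (by linarith)).const_mul
      (2 * (N : ℝ) * (2 * z + N - 1))
    have e3 := (tendsto_div_sq_atTop hN hz0).const_mul (1 - N - c)
    have e4 : Tendsto (fun d : ℕ => (N : ℝ) / (N + d)) atTop (nhds 0) :=
      tendsto_const_nhds.div_atTop (tendsto_atTop_add_const_left _ _ tendsto_natCast_atTop_atTop)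
    simpa only [sub_zero, mul_zero, add_zero] using ((e1.sub e4).add e2).sub e3
  · have hD : 0 < 2 * (N : ℝ) ^ 2 - 2 * N + 1 := by nlinarith
    have hE : 0 < 2 * ((N : ℝ) + z) ^ 2 - 2 * (N + z) + 1 := by nlinarith
    simp only [W, τ, Nat.cast_zero, add_zero, zero_div, mul_zero, sub_zero]
    rw [div_self (by linarith), mul_one_div, div_sub' hD.ne', div_add_div _ _ hD.ne' hE.ne']
    refine div_nonneg ?_ (by positivity)
    have : 0 ≤ z * (1 - z) := mul_nonneg hz0 (by linarith [hz.2])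
    nlinarith [mul_nonneg this (show 0 ≤ (N : ℝ) * (N - 1) by nlinarith)]

end Estimates

/-- The transfer operator on the densities `fDens`. -/
noncomputable def renyiTransfer (N : ℕ) (f : ℝ → ℝ) (z : ℝ) : ℝ :=
  ∑' d, renyiWeight N d z * f (renyiBranch N d z)

/-- The termwise derivative of `renyiTransfer N f`, where `f'` is the derivative of `f`. -/
noncomputable def renyiTransferDeriv (N : ℕ) (f f' : ℝ → ℝ) (z : ℝ) : ℝ :=
  ∑' d, (renyiWeightDeriv N d z * f (renyiBranch N d z) +
    renyiWeight N d z * (f' (renyiBranch N d z) * (N / (N + d + z) ^ 2)))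

section Transfer

variable {N : ℕ} {f f' : ℝ → ℝ} {M : ℝ}

theorem abs_sub_le_of_hasDerivAt (hf : ∀ x, HasDerivAt f (f' x) x) (hM : ∀ x, |f' x| ≤ M)
    (x y : ℝ) : |f y - f x| ≤ M * |y - x| :=
  Convex.norm_image_sub_le_of_norm_hasDerivWithin_le (fun x _ => (hf x).hasDerivWithinAt)
    (fun x _ => hM x) convex_univ (mem_univ x) (mem_univ y)

theorem abs_apply_renyiBranch_le (hN : 2 ≤ N) (hf : ∀ x, HasDerivAt f (f' x) x)
    (hM : ∀ x, |f' x| ≤ M) (d : ℕ) {z : ℝ} (hz : z ∈ Ioo (-1 / 2 : ℝ) (3 / 2)) :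
    |f (renyiBranch N d z)| ≤ |f 0| + M := by
  have h1 := abs_sub_le_of_hasDerivAt hf hM 0 (renyiBranch N d z)
  have h2 := abs_renyiBranch_le_one hN d hz
  have h3 : 0 ≤ M := (abs_nonneg _).trans (hM 0)
  have h4 := abs_sub_abs_le_abs_sub (f (renyiBranch N d z)) (f 0)
  rw [sub_zero] at h1
  nlinarith

theorem abs_renyiTransferDeriv_term_le (hN : 2 ≤ N) (hf : ∀ x, HasDerivAt f (f' x) x)
    (hM : ∀ x, |f' x| ≤ M) (d : ℕ) {z : ℝ} (hz : z ∈ Ioo (-1 / 2 : ℝ) (3 / 2)) :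
    |renyiWeightDeriv N d z * f (renyiBranch N d z) +
      renyiWeight N d z * (f' (renyiBranch N d z) * (N / (N + d + z) ^ 2))| ≤
    (2 * (|f 0| + M) + 2 * (N + 1) * (M * N)) * (1 / ((d : ℝ) + 1) ^ 2) := by
  have hM0 : 0 ≤ M := (abs_nonneg _).trans (hM 0)
  have hd : (0 : ℝ) ≤ d := d.cast_nonneg
  have hC : 0 ≤ |f 0| + M := by positivity
  have h1 := mul_le_mul (abs_renyiWeightDeriv_le hN d hz.1)
    (abs_apply_renyiBranch_le hN hf hM d hz) (abs_nonneg _) (by positivity)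
  have h5 : 1 / ((d : ℝ) + 1) ^ 2 ≤ 1 := by
    rw [div_le_one (by positivity)]; nlinarith
  have h6 : |(N : ℝ) / (N + d + z) ^ 2| ≤ N :=
    (abs_renyiBranch_deriv_le hN d hz.1).trans (mul_le_of_le_one_right (by positivity) h5)
  have h2 := mul_le_mul (abs_renyiWeight_le hN d hz)
    (mul_le_mul (hM (renyiBranch N d z)) h6 (abs_nonneg _) hM0)
    (by positivity) (by positivity)
  refine (abs_add_le _ _).trans ?_
  rw [abs_mul, abs_mul, abs_mul]
  refine (add_le_add h1 h2).trans (le_of_eq ?_)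
  ring

theorem hasDerivAt_renyiTransfer (hN : 2 ≤ N) (hf : ∀ x, HasDerivAt f (f' x) x)
    (hM : ∀ x, |f' x| ≤ M) {z : ℝ} (hz : z ∈ Ioo (-1 / 2 : ℝ) (3 / 2)) :
    HasDerivAt (renyiTransfer N f) (renyiTransferDeriv N f f' z) z := by
  have hN' : (2 : ℝ) ≤ N := by exact_mod_cast hN
  refine hasDerivAt_tsum_of_isPreconnected (y₀ := 0)
    (g' := fun d y => renyiWeightDeriv N d y * f (renyiBranch N d y) +
      renyiWeight N d y * (f' (renyiBranch N d y) * (N / (N + d + y) ^ 2)))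
    (summable_one_div_succ_sq.mul_left (2 * (|f 0| + M) + 2 * (N + 1) * (M * N))) isOpen_Ioo
    isPreconnected_Ioo (fun d y hy => ?_)
    (fun d y hy => abs_renyiTransferDeriv_term_le hN hf hM d hy) (by norm_num) ?_ hz
  · have hd : (0 : ℝ) ≤ d := d.cast_nonneg
    have hb : 0 < (N : ℝ) + d + y - 1 := by linarith [hy.1]
    exact (hasDerivAt_renyiWeight d hb).mul
      ((hf _).comp y (hasDerivAt_renyiBranch d (by linarith)))
  · refine .of_norm_bounded (summable_one_div_succ_sq.mul_left ((N + 1) * 2 * (|f 0| + M)))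
      fun d => ?_
    have h0 : (0 : ℝ) ∈ Ioo (-1 / 2 : ℝ) (3 / 2) := by norm_num
    rw [Real.norm_eq_abs, abs_mul]
    refine (mul_le_mul (abs_renyiWeight_le hN d h0) (abs_apply_renyiBranch_le hN hf hM d h0)
      (abs_nonneg _) (by positivity)).trans (le_of_eq ?_)
    ring

theorem Icc_subset_Ioo_thickening : Icc (0 : ℝ) 1 ⊆ Ioo (-1 / 2 : ℝ) (3 / 2) :=
  Icc_subset_Ioo (by norm_num) (by norm_num)

/-- The weights change from decreasing to increasing at a single index. -/
theorem exists_renyiWeightDeriv_sign (N : ℕ) (z : ℝ) :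
    ∃ k : ℕ, (∀ d < k, renyiWeightDeriv N d z ≤ 0) ∧ ∀ d ≥ k, 0 ≤ renyiWeightDeriv N d z := by
  have hex : ∃ k : ℕ, (z + N - 1) ^ 2 ≤ (k : ℝ) ^ 2 + k := by
    obtain ⟨k, hk⟩ := exists_nat_ge ((z + N - 1) ^ 2)
    exact ⟨k, by nlinarith [sq_nonneg (k : ℝ)]⟩
  classical
  refine ⟨Nat.find hex, fun d hd => ?_, fun d hd => ?_⟩
  · have := not_le.1 (Nat.find_min hex hd)
    exact div_nonpos_of_nonpos_of_nonneg (by linarith) (by positivity)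
  · have h1 := Nat.find_spec hex
    have h2 : (Nat.find hex : ℝ) ≤ d := by exact_mod_cast hd
    exact div_nonneg (by nlinarith [(Nat.find hex).cast_nonneg (α := ℝ)]) (by positivity)

theorem abs_renyiTransferDeriv_le (hN : 2 ≤ N) (hf : ∀ x, HasDerivAt f (f' x) x)
    (hM : ∀ x, |f' x| ≤ M) {z : ℝ} (hz : z ∈ Icc (0 : ℝ) 1) :
    |renyiTransferDeriv N f f' z| ≤ qConst N * M := by
  have hN0 : 0 < N := by omega
  have hN' : (2 : ℝ) ≤ N := by exact_mod_cast hN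
  have hz0 := hz.1
  have hzI := Icc_subset_Ioo_thickening hz
  obtain ⟨k, hk1, hk2⟩ := exists_renyiWeightDeriv_sign N z
  have hsum := hasSum_renyiWeightDeriv hN hz0
  have hT : HasSum (fun d => renyiWeightDeriv N d z * (f (renyiBranch N d z) -
      f (renyiBranch N k z)) + renyiWeight N d z * (f' (renyiBranch N d z) * (N / (N + d + z) ^ 2)))
      (renyiTransferDeriv N f f' z) := by
    have h1 : Summable fun d => renyiWeightDeriv N d z * f (renyiBranch N d z) +
        renyiWeight N d z * (f' (renyiBranch N d z) * (N / (N + d + z) ^ 2)) :=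
      .of_norm_bounded (summable_one_div_succ_sq.mul_left _)
        fun d => abs_renyiTransferDeriv_term_le hN hf hM d hzI
    have h2 := h1.hasSum.sub (hsum.mul_right (f (renyiBranch N k z)))
    rw [zero_mul, sub_zero] at h2
    refine h2.congr_fun fun d => ?_
    ring
  have hS : Summable fun d => renyiWeightDeriv N d z * (renyiBranch N d z -
      renyiBranch N k z) + renyiWeight N d z * (N / (N + d + z) ^ 2) := by
    have h1 : Summable fun d => renyiWeightDeriv N d z * renyiBranch N d z +
        renyiWeight N d z * (1 * (N / (N + d + z) ^ 2)) :=
      .of_norm_bounded (summable_one_div_succ_sq.mul_left _)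
        fun d => abs_renyiTransferDeriv_term_le (f := id) (f' := fun _ => 1) (M := 1) hN
          hasDerivAt_id (by simp) d hzI
    refine (h1.sub (hsum.summable.mul_right (renyiBranch N k z))).congr fun d => ?_
    ring
  have hq := renyi_series_le_qConst hN hz _ hS.hasSum
  have hM0 : 0 ≤ M := (abs_nonneg _).trans (hM 0)
  refine le_trans ?_ (mul_le_mul_of_nonneg_right hq hM0)
  rw [← hT.tsum_eq, ← Real.norm_eq_abs]
  refine tsum_of_norm_bounded (hS.hasSum.mul_right M) fun d => ?_
  rw [Real.norm_eq_abs]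
  refine (abs_add_le _ _).trans ?_
  rw [add_mul]
  have hd : (0 : ℝ) ≤ d := d.cast_nonneg
  have hb : 0 < (N : ℝ) + d + z - 1 := by linarith
  have hb' : 0 < (N : ℝ) + d + z := by linarith
  have hw : 0 ≤ renyiWeight N d z := div_nonneg (by linarith) (by positivity)
  refine add_le_add ?_ ?_
  · have hL := abs_sub_le_of_hasDerivAt hf hM (renyiBranch N k z) (renyiBranch N d z)
    have hmono := renyiBranch_monotone_index hN0 hz0
    have hsign : |renyiWeightDeriv N d z| * |renyiBranch N d z - renyiBranch N k z| =
        renyiWeightDeriv N d z * (renyiBranch N d z - renyiBranch N k z) := by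
      rw [← abs_mul, abs_of_nonneg]
      rcases lt_or_ge d k with h | h
      · exact mul_nonneg_of_nonpos_of_nonpos (hk1 d h) (sub_nonpos.2 (hmono h.le))
      · exact mul_nonneg (hk2 d h) (sub_nonneg.2 (hmono h))
    rw [abs_mul, ← hsign, mul_assoc, mul_comm _ M]
    exact mul_le_mul_of_nonneg_left hL (abs_nonneg _)
  · rw [abs_mul, abs_mul, abs_of_nonneg hw, mul_assoc, mul_comm _ M,
      abs_of_nonneg (by positivity : (0 : ℝ) ≤ N / (N + d + z) ^ 2)]
    gcongr
    exact hM _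

theorem hasDerivWithinAt_Fdist_succ (hN : 2 ≤ N) (μ : Measure ℝ) [IsFiniteMeasure μ]
    [NullSingletonClass μ] (n : ℕ) (hf : Continuous f)
    (hF : ∀ x ∈ Icc (0 : ℝ) 1, HasDerivWithinAt (Fdist N μ n) (f x / (x + N - 1)) (Icc 0 1) x)
    {x : ℝ} (hx : x ∈ Icc (0 : ℝ) 1) :
    HasDerivWithinAt (Fdist N μ (n + 1)) (renyiTransfer N f x / (x + N - 1)) (Icc 0 1) x := by
  have hN0 : 0 < N := by omega
  have hN' : (2 : ℝ) ≤ N := by exact_mod_cast hN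
  obtain ⟨G, hGF, hG⟩ := exists_hasDerivAt_extension (f' := fun x => f x / (x + N - 1)) hF
  have hcont : ContinuousOn (fun x => f x / (x + N - 1)) (Icc (0 : ℝ) 1) :=
    hf.continuousOn.div (by fun_prop) fun y hy => by linarith [hy.1]
  obtain ⟨C, hC⟩ := isCompact_Icc.exists_bound_of_continuousOn hcont
  have hC0 : 0 ≤ C := (norm_nonneg _).trans (hC 0 (by simp))
  have hbranch : ∀ d, ∀ y ∈ Icc (0 : ℝ) 1, renyiBranch N d y ∈ Icc (0 : ℝ) 1 := fun d y hy =>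
    ⟨renyiBranch_nonneg hN0 hy.1, (renyiBranch_lt_one hN0 hy.1).le⟩
  have hder := hasDerivAt_tsum_of_isPreconnected (y₀ := 0) (y := x)
    (g := fun d y => G (renyiBranch N d y) - G (renyiBranch N d 0))
    (g' := fun d y => (fun x => f x / (x + N - 1))
      (projIcc (0 : ℝ) 1 zero_le_one (renyiBranch N d y)) * (N / (N + d + y) ^ 2))
    (summable_one_div_succ_sq.mul_left (C * N)) (isOpen_Ioo (a := (-1 / 2 : ℝ)) (b := 3 / 2))
    isPreconnected_Ioo (fun d y hy => ?_) (fun d y hy => ?_) (by norm_num) (by simp)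
    (Icc_subset_Ioo_thickening hx)
  · refine (hder.hasDerivWithinAt (s := Icc 0 1)).congr_deriv ?_ |>.congr (fun y hy => ?_) ?_
    · rw [renyiTransfer, ← tsum_div_const]
      refine tsum_congr fun d => ?_
      rw [projIcc_of_mem _ (hbranch d x hx)]
      have hd : (0 : ℝ) ≤ d := d.cast_nonneg
      have hx0 := hx.1
      have h1 : (N : ℝ) + d + x ≠ 0 := by linarith
      have h2 : (N : ℝ) + d + x - 1 ≠ 0 := by linarith
      have h3 : x + (N : ℝ) - 1 ≠ 0 := by linarith
      have h4 : renyiBranch N d x + N - 1 = N * (N + d + x - 1) / (N + d + x) := by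
        rw [renyiBranch]; field_simp; ring
      simp only [h4, renyiWeight]
      generalize f (renyiBranch N d x) = v
      field_simp
    all_goals
      rw [← (hasSum_Fdist_succ hN μ n (by assumption)).tsum_eq]
      refine tsum_congr fun d => ?_
      rw [hGF (hbranch d _ (by assumption)), hGF (hbranch d 0 (by simp))]
  · have hd : (0 : ℝ) ≤ d := d.cast_nonneg
    exact ((hG _).comp y (hasDerivAt_renyiBranch d (by linarith [hy.1]))).sub_const _
  · rw [norm_mul, mul_assoc]
    exact mul_le_mul (hC _ (projIcc (0 : ℝ) 1 zero_le_one (renyiBranch N d y)).2)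
      (abs_renyiBranch_deriv_le hN d hy.1) (norm_nonneg _) hC0

end Transfer

/-- The distribution function `Fdist N μ n` has on `[0,1]` the derivative `f x / (x + N - 1)` for
some differentiable `f` on `ℝ` with `|f'| ≤ M`. -/
def HasDensityBound (N : ℕ) (μ : Measure ℝ) (n : ℕ) (M : ℝ) : Prop :=
  ∃ f f' : ℝ → ℝ, (∀ x, HasDerivAt f (f' x) x) ∧ (∀ x, |f' x| ≤ M) ∧
    ∀ x ∈ Icc (0 : ℝ) 1, HasDerivWithinAt (Fdist N μ n) (f x / (x + N - 1)) (Icc 0 1) x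

section DensityBound

variable {N : ℕ} {μ : Measure ℝ} {n : ℕ} {M : ℝ}

theorem HasDensityBound.Mconst_le (hN : 2 ≤ N) (h : HasDensityBound N μ n M) :
    Mconst N μ n ≤ M := by
  obtain ⟨f, f', hf, hM, hF⟩ := h
  have hN' : (2 : ℝ) ≤ N := by exact_mod_cast hN
  have hu : UniqueDiffOn ℝ (Icc (0 : ℝ) 1) := uniqueDiffOn_Icc zero_lt_one
  have heq : EqOn (fDens N μ n) f (Icc 0 1) := fun x hx => by
    have : x + (N : ℝ) - 1 ≠ 0 := by linarith [hx.1]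
    rw [fDens, (hF x hx).derivWithin (hu x hx)]
    field_simp
  refine csSup_le ((nonempty_Icc.2 zero_le_one).image _) ?_
  rintro _ ⟨x, hx, rfl⟩
  have := ((hf x).hasDerivWithinAt (s := Icc 0 1)).congr heq (heq hx)
  simp only [this.derivWithin (hu x hx)]
  exact hM x

theorem hasDensityBound_zero (hN : 2 ≤ N) (hsmooth : ContDiffOn ℝ 2 (Fdist N μ 0) (Icc 0 1)) :
    HasDensityBound N μ 0 (Mconst N μ 0) := by
  have hN' : (2 : ℝ) ≤ N := by exact_mod_cast hN
  have hu : UniqueDiffOn ℝ (Icc (0 : ℝ) 1) := uniqueDiffOn_Icc zero_lt_one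
  have h1 : ContDiffOn ℝ 1 (fDens N μ 0) (Icc 0 1) := by
    have := hsmooth.derivWithin hu (m := 1) (by norm_num)
    unfold fDens
    exact ContDiffOn.mul (by fun_prop) this
  have hbdd : BddAbove ((fun x => |derivWithin (fDens N μ 0) (Icc 0 1) x|) '' Icc (0 : ℝ) 1) :=
    (isCompact_Icc.image_of_continuousOn (h1.continuousOn_derivWithin hu le_rfl).abs).bddAbove
  obtain ⟨g, hg, hg'⟩ := exists_hasDerivAt_extension fun x hx =>
    (h1.differentiableOn (by norm_num) x hx).hasDerivWithinAt
  refine ⟨g, _, hg', fun x => le_csSup hbdd (mem_image_of_mem _ (Subtype.prop _)),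
    fun x hx => ?_⟩
  have hne : x + (N : ℝ) - 1 ≠ 0 := by linarith [hx.1]
  rw [hg hx, fDens, mul_div_cancel_left₀ _ hne]
  exact (hsmooth.differentiableOn (by norm_num) x hx).hasDerivWithinAt

theorem HasDensityBound.succ (hN : 2 ≤ N) [IsFiniteMeasure μ] [NullSingletonClass μ]
    (h : HasDensityBound N μ n M) : HasDensityBound N μ (n + 1) (qConst N * M) := by
  obtain ⟨f, f', hf, hM, hF⟩ := h
  obtain ⟨g, hg, hg'⟩ := exists_hasDerivAt_extension fun x hx =>
    (hasDerivAt_renyiTransfer hN hf hM (Icc_subset_Ioo_thickening hx)).hasDerivWithinAt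
  refine ⟨g, _, hg', fun x => abs_renyiTransferDeriv_le hN hf hM (Subtype.prop _),
    fun x hx => ?_⟩
  rw [hg hx]
  exact hasDerivWithinAt_Fdist_succ hN μ n
    (continuous_iff_continuousAt.2 fun y => (hf y).continuousAt) hF hx

end DensityBound

theorem Mconst_geometric (N : ℕ) (hN : 2 ≤ N) (μ : Measure ℝ)
    [IsProbabilityMeasure μ] [NullSingletonClass μ] (hsupp : μ (Icc (0 : ℝ) 1)ᶜ = 0)
    (hsmooth : ContDiffOn ℝ 2 (Fdist N μ 0) (Icc 0 1)) :
    ∀ n : ℕ, Mconst N μ n ≤ qConst N ^ n * Mconst N μ 0 := by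
  intro n
  refine HasDensityBound.Mconst_le hN ?_
  induction n with
  | zero => simpa using hasDensityBound_zero hN hsmooth
  | succ n ih =>
    rw [pow_succ', mul_assoc]
    exact ih.succ hN
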